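/- arXiv:2405.12956 — 11 statements merged into one kernel-verified Lean document; each statement's English description precedes it below -/
import Mathlib

section
/- For all real numbers a, b, c, d, the matrix M₂(a,b,c,d) satisfies μ(M₂(a,b,c,d)) = 0; equivalently, M₂(a,b,c,d)·M₂(a,b,c,d)* = (1/2)·tr(M₂(a,b,c,d)·M₂(a,b,c,d)*)·1₂. -/
open Matrix

noncomputable section

/-- The moment map on 2×3 complex matrices. -/
def mu (ψ : Matrix (Fin 2) (Fin 3) ℂ) : Matrix (Fin 2) (Fin 2) ℂ :=
  ψ * ψᴴ - ((1 / 2 : ℂ) * Matrix.trace (ψ * ψᴴ)) • (1 : Matrix (Fin 2) (Fin 2) ℂ)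

/-- The real inner product ⟨φ,ψ⟩ = (1/2)·Re(tr(φ·ψ*)). -/
def ip (φ ψ : Matrix (Fin 2) (Fin 3) ℂ) : ℝ :=
  (1 / 2) * (Matrix.trace (φ * ψᴴ)).re

/-- M₁(a,b,c,d). -/
def M1 (a b c d : ℝ) : Matrix (Fin 2) (Fin 3) ℂ :=
  !![⟨-b, a⟩, ⟨c, -d⟩, 0; ⟨-d, c⟩, ⟨-a, b⟩, 0]

/-- M₂(a,b,c,d). -/
def M2 (a b c d : ℝ) : Matrix (Fin 2) (Fin 3) ℂ :=
  !![⟨-b, a⟩, 0, ⟨d, c⟩; ⟨-d, c⟩, 0, ⟨-b, -a⟩]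

/-- The embedding ι(a,b,c,d). -/
def iota (a b c d : ℝ) : Matrix (Fin 2) (Fin 3) ℂ :=
  !![⟨-b, a⟩, ⟨-c, d⟩, ⟨-d, -c⟩; ⟨-d, c⟩, ⟨a, -b⟩, ⟨b, a⟩]

/-- Membership in the space W of 3/2-spinors. -/
def inW (φ : Matrix (Fin 2) (Fin 3) ℂ) : Prop :=
  ∀ a b c d : ℝ, ip φ (iota a b c d) = 0

/-- The parametrization Ψ(a,b,c,d,λ) of W ∩ μ⁻¹(0). -/
def Psi (a b c d l : ℝ) : Matrix (Fin 2) (Fin 3) ℂ :=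
  !![⟨-(b - l * a), a + l * b⟩, ⟨c, -d⟩, ⟨-(l * c), l * d⟩;
     ⟨-(d - l * c), c + l * d⟩, ⟨-a, b⟩, ⟨l * a, -(l * b)⟩]

theorem M2_mul_conjTranspose (a b c d : ℝ) :
    M2 a b c d * (M2 a b c d)ᴴ =
      ((a ^ 2 + b ^ 2 + c ^ 2 + d ^ 2 : ℝ) : ℂ) • (1 : Matrix (Fin 2) (Fin 2) ℂ) := by
  ext i j
  fin_cases i <;> fin_cases j <;> apply Complex.ext <;>
    simp [M2, Matrix.mul_apply, Fin.sum_univ_three, -Complex.ofReal_add, -Complex.ofReal_pow] <;>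
    ring

theorem moment_map_vanishes_on_M2 (a b c d : ℝ) :
    mu (M2 a b c d) = 0 ∧
    M2 a b c d * (M2 a b c d)ᴴ =
      ((1 / 2 : ℂ) * Matrix.trace (M2 a b c d * (M2 a b c d)ᴴ)) •
        (1 : Matrix (Fin 2) (Fin 2) ℂ) := by
  have h : M2 a b c d * (M2 a b c d)ᴴ =
      ((1 / 2 : ℂ) * Matrix.trace (M2 a b c d * (M2 a b c d)ᴴ)) •
        (1 : Matrix (Fin 2) (Fin 2) ℂ) := by
    rw [M2_mul_conjTranspose, Matrix.trace_smul, Matrix.trace_one, Fintype.card_fin, smul_eq_mul]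
    congr 1
    push_cast
    ring
  exact ⟨sub_eq_zero.mpr h, h⟩
end
end

section
/- The ℝ-linear map from ℝ⁴ × ℝ⁴ to the space of 2×3 complex matrices sending ((a₁,b₁,c₁,d₁),(a₂,b₂,c₂,d₂)) to M₁(a₁,b₁,c₁,d₁) + M₂(a₂,b₂,c₂,d₂) is injective, and its range is exactly W. In particular, W is the internal direct sum of the subspaces W₁ = {M₁(a,b,c,d) : a,b,c,d ∈ ℝ} and W₂ = {M₂(a,b,c,d) : a,b,c,d ∈ ℝ}. -/
open Matrix

noncomputable section

/-- The pairing with `iota a b c d`, written in coordinates. -/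
lemma ip_iota (φ : Matrix (Fin 2) (Fin 3) ℂ) (a b c d : ℝ) :
    ip φ (iota a b c d) = (1 / 2) *
      (a * ((φ 0 0).im + (φ 1 1).re + (φ 1 2).im) +
        b * ((φ 1 2).re - (φ 0 0).re - (φ 1 1).im) +
        c * ((φ 1 0).im - (φ 0 1).re - (φ 0 2).im) +
        d * ((φ 0 1).im - (φ 0 2).re - (φ 1 0).re)) := by
  simp [ip, iota, Matrix.trace, Matrix.mul_apply, Fin.sum_univ_succ]
  ring

/-- The four real linear equations cutting out the space of 3/2-spinors. -/
lemma inW_iff (φ : Matrix (Fin 2) (Fin 3) ℂ) :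
    inW φ ↔
      (φ 0 0).im + (φ 1 1).re + (φ 1 2).im = 0 ∧
      (φ 1 2).re - (φ 0 0).re - (φ 1 1).im = 0 ∧
      (φ 1 0).im - (φ 0 1).re - (φ 0 2).im = 0 ∧
      (φ 0 1).im - (φ 0 2).re - (φ 1 0).re = 0 := by
  simp only [inW, ip_iota]
  constructor
  · intro h
    have ha := h 1 0 0 0
    have hb := h 0 1 0 0
    have hc := h 0 0 1 0
    have hd := h 0 0 0 1
    refine ⟨?_, ?_, ?_, ?_⟩ <;> linarith
  · rintro ⟨ha, hb, hc, hd⟩ a b c d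
    simp [ha, hb, hc, hd]

theorem W_direct_sum_decomposition :
    Function.Injective (fun p : (ℝ × ℝ × ℝ × ℝ) × (ℝ × ℝ × ℝ × ℝ) =>
      M1 p.1.1 p.1.2.1 p.1.2.2.1 p.1.2.2.2 + M2 p.2.1 p.2.2.1 p.2.2.2.1 p.2.2.2.2) ∧
    Set.range (fun p : (ℝ × ℝ × ℝ × ℝ) × (ℝ × ℝ × ℝ × ℝ) =>
      M1 p.1.1 p.1.2.1 p.1.2.2.1 p.1.2.2.2 + M2 p.2.1 p.2.2.1 p.2.2.2.1 p.2.2.2.2) =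
      {φ : Matrix (Fin 2) (Fin 3) ℂ | inW φ} := by
  constructor
  · rintro ⟨⟨a, b, c, d⟩, a', b', c', d'⟩ ⟨⟨x, y, z, w⟩, x', y', z', w'⟩ h
    have h₁ := congrFun (congrFun h 0) 1
    have h₂ := congrFun (congrFun h 0) 2
    have h₃ := congrFun (congrFun h 1) 1
    have h₄ := congrFun (congrFun h 1) 2
    simp [M1, M2, Complex.ext_iff] at h₁ h₂ h₃ h₄
    simp [h₁, h₂, h₃, h₄]
  · ext φ
    rw [Set.mem_ofPred_eq, inW_iff]
    constructor
    · rintro ⟨p, rfl⟩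
      refine ⟨?_, ?_, ?_, ?_⟩ <;> simp [M1, M2] <;> ring
    · rintro ⟨ha, hb, hc, hd⟩
      refine ⟨((-(φ 1 1).re, (φ 1 1).im, (φ 0 1).re, -(φ 0 1).im),
        (-(φ 1 2).im, -(φ 1 2).re, (φ 0 2).im, (φ 0 2).re)), ?_⟩
      ext i j
      fin_cases i <;> fin_cases j <;> apply Complex.ext <;> simp [M1, M2] <;> linarith
end
end

section
/- Let (a₁,b₁,c₁,d₁) ∈ ℝ⁴ with (a₁,b₁,c₁,d₁) ≠ (0,0,0,0) and let (a₂,b₂,c₂,d₂) ∈ ℝ⁴. Then μ(M₁(a₁,b₁,c₁,d₁) + M₂(a₂,b₂,c₂,d₂)) = 0 if and only if there exists λ ∈ ℝ such that (a₂,b₂,c₂,d₂) = λ·(b₁, −a₁, d₁, −c₁). -/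
open Matrix

noncomputable section

/-- The moment map of `M1 + M2` vanishes exactly when three equations, linear in the parameters
of `M2`, hold. -/
theorem mu_M1_add_M2_eq_zero_iff (a1 b1 c1 d1 a2 b2 c2 d2 : ℝ) :
    mu (M1 a1 b1 c1 d1 + M2 a2 b2 c2 d2) = 0 ↔
      a1 * a2 + b1 * b2 - c1 * c2 - d1 * d2 = 0 ∧
      c1 * a2 + d1 * b2 + a1 * c2 + b1 * d2 = 0 ∧
      -d1 * a2 + c1 * b2 + b1 * c2 - a1 * d2 = 0 := by
  rw [← Matrix.ext_iff]
  simp only [Fin.forall_fin_two, mu, Matrix.sub_apply, Matrix.smul_apply, Matrix.trace_fin_two,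
    Matrix.mul_apply, Matrix.conjTranspose_apply, Fin.sum_univ_three]
  simp [M1, M2, Complex.ext_iff]
  constructor
  · rintro ⟨⟨⟨h1, -⟩, h2, h3⟩, -⟩
    refine ⟨?_, ?_, ?_⟩ <;> linarith
  · rintro ⟨h1, h2, h3⟩
    refine ⟨⟨⟨?_, ?_⟩, ?_, ?_⟩, ⟨?_, ?_⟩, ?_, ?_⟩ <;> linarith

theorem moment_map_zero_iff_lambda (a1 b1 c1 d1 a2 b2 c2 d2 : ℝ)
    (h : (a1, b1, c1, d1) ≠ (0, 0, 0, 0)) :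
    mu (M1 a1 b1 c1 d1 + M2 a2 b2 c2 d2) = 0 ↔
      ∃ l : ℝ, (a2, b2, c2, d2) = (l * b1, l * -a1, l * d1, l * -c1) := by
  rw [mu_M1_add_M2_eq_zero_iff]
  simp only [Prod.mk.injEq]
  constructor
  · rintro ⟨h1, h2, h3⟩
    have hN : a1 ^ 2 + b1 ^ 2 + c1 ^ 2 + d1 ^ 2 ≠ 0 := by
      contrapose! h
      simp only [Prod.mk.injEq]
      refine ⟨?_, ?_, ?_, ?_⟩ <;> nlinarith [sq_nonneg a1, sq_nonneg b1, sq_nonneg c1, sq_nonneg d1]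
    refine ⟨(b1 * a2 - a1 * b2 + d1 * c2 - c1 * d2) / (a1 ^ 2 + b1 ^ 2 + c1 ^ 2 + d1 ^ 2),
      ?_, ?_, ?_, ?_⟩ <;> rw [div_mul_eq_mul_div, eq_div_iff hN]
    · linear_combination a1 * h1 + c1 * h2 - d1 * h3
    · linear_combination b1 * h1 + d1 * h2 + c1 * h3
    · linear_combination -c1 * h1 + a1 * h2 + b1 * h3
    · linear_combination -d1 * h1 + b1 * h2 - a1 * h3
  · rintro ⟨l, rfl, rfl, rfl, rfl⟩
    refine ⟨?_, ?_, ?_⟩ <;> ring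
end
end

section
/- For all real numbers a, b, c, d, λ, the matrix Ψ(a,b,c,d,λ) satisfies μ(Ψ(a,b,c,d,λ)) = 0. -/
open Matrix

noncomputable section

theorem moment_map_vanishes_on_Psi (a b c d l : ℝ) :
    mu (Psi a b c d l) = 0 := by
  ext i j
  fin_cases i <;> fin_cases j <;> apply Complex.ext <;>
    simp [mu, Psi, Matrix.trace, Matrix.vecMul, dotProduct, Fin.sum_univ_succ] <;> ring
end
end

section
/- The parametrization Ψ is injective on the set where the first four coordinates are not all zero: if (a,b,c,d) ≠ (0,0,0,0) and Ψ(a,b,c,d,λ) = Ψ(a',b',c',d',λ'), then (a,b,c,d,λ) = (a',b',c',d',λ'). -/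
open Matrix

noncomputable section

theorem Psi_injective (a b c d l a' b' c' d' l' : ℝ)
    (h : (a, b, c, d) ≠ (0, 0, 0, 0))
    (heq : Psi a b c d l = Psi a' b' c' d' l') :
    (a, b, c, d, l) = (a', b', c', d', l') := by
  have entry (i : Fin 2) (j : Fin 3) : Psi a b c d l i j = Psi a' b' c' d' l' i j := by
    rw [heq]
  have h01 := entry 0 1
  have h02 := entry 0 2
  have h11 := entry 1 1
  have h12 := entry 1 2
  simp only [Psi, Matrix.of_apply, Matrix.cons_val', Matrix.cons_val_zero, Matrix.cons_val_one,
    Matrix.cons_val, Complex.mk.injEq, neg_inj] at h01 h02 h11 h12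
  obtain ⟨rfl, rfl⟩ := h01
  obtain ⟨rfl, rfl⟩ := h11
  have hl : l = l' := by
    by_contra hne
    simp_all [mul_eq_mul_right_iff]
  rw [hl]
end
end

section
/- For every λ ∈ ℝ and every (a,b,c,d) ∈ ℝ⁴ with (a,b,c,d) ≠ (0,0,0,0), the five 2×3 complex matrices T_a(λ), T_b(λ), T_c(λ), T_d(λ), and T_λ(a,b,c,d) are linearly independent over ℝ. -/
open Matrix

noncomputable section

/-- T_a(λ). -/
def Ta (l : ℝ) : Matrix (Fin 2) (Fin 3) ℂ :=
  !![⟨l, 1⟩, 0, 0; 0, -1, ⟨l, 0⟩]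

/-- T_b(λ). -/
def Tb (l : ℝ) : Matrix (Fin 2) (Fin 3) ℂ :=
  !![⟨-1, l⟩, 0, 0; 0, ⟨0, 1⟩, ⟨0, -l⟩]

/-- T_c(λ). -/
def Tc (l : ℝ) : Matrix (Fin 2) (Fin 3) ℂ :=
  !![0, 1, ⟨-l, 0⟩; ⟨l, 1⟩, 0, 0]

/-- T_d(λ). -/
def Td (l : ℝ) : Matrix (Fin 2) (Fin 3) ℂ :=
  !![0, ⟨0, -1⟩, ⟨0, l⟩; ⟨-1, l⟩, 0, 0]

/-- T_λ(a,b,c,d). -/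
def Tlam (a b c d : ℝ) : Matrix (Fin 2) (Fin 3) ℂ :=
  !![⟨a, b⟩, 0, ⟨-c, d⟩; ⟨c, d⟩, 0, ⟨a, -b⟩]

theorem tangent_frame_linearly_independent (l a b c d : ℝ)
    (h : (a, b, c, d) ≠ (0, 0, 0, 0)) :
    LinearIndependent ℝ ![Ta l, Tb l, Tc l, Td l, Tlam a b c d] := by
  rw [Fintype.linearIndependent_iff]
  intro g hg
  have entry (i : Fin 2) (j : Fin 3) := congrFun (congrFun hg i) j
  have h00 := entry 0 0
  have h01 := entry 0 1
  have h10 := entry 1 0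
  have h11 := entry 1 1
  simp [Fin.sum_univ_five, Ta, Tb, Tc, Td, Tlam, Complex.ext_iff] at h00 h01 h10 h11
  obtain ⟨h2, h3⟩ := h01
  obtain ⟨h0, h1⟩ := h11
  simp [h0, h1] at h00
  simp [h2, h3] at h10
  have h4 : g 4 = 0 := by
    by_contra h4
    simp_all
  intro i
  fin_cases i <;> assumption
end
end

section
/- Let φ be a nonzero 2×3 complex matrix with φ ∈ W and μ(φ) = 0. Then either there exist real numbers (a,b,c,d) ≠ (0,0,0,0) and λ ∈ ℝ such that φ = Ψ(a,b,c,d,λ), or there exist real numbers (a,b,c,d) ≠ (0,0,0,0) such that φ = M₂(a,b,c,d). -/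
open Matrix

noncomputable section

/-- If two quaternions `p = (x, y, u, v) ≠ 0` and `q = (x', y', u', v')` satisfy `Im (conj p * q) = 0`,
then `q` is a real multiple of `p`. -/
theorem exists_real_smul_of_im_conj_mul_eq_zero {x y u v x' y' u' v' : ℝ}
    (hp : x ^ 2 + y ^ 2 + u ^ 2 + v ^ 2 ≠ 0)
    (h1 : y * x' - x * y' - (v * u' - u * v') = 0)
    (h2 : x * u' - u * x' + (y * v' - v * y') = 0)
    (h3 : x * v' - v * x' - (y * u' - u * y') = 0) :
    ∃ t : ℝ, x' = t * x ∧ y' = t * y ∧ u' = t * u ∧ v' = t * v := by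
  refine ⟨(x * x' + y * y' + u * u' + v * v') / (x ^ 2 + y ^ 2 + u ^ 2 + v ^ 2),
    ?_, ?_, ?_, ?_⟩ <;> rw [div_mul_eq_mul_div, eq_div_iff hp]
  · linear_combination y * h1 - u * h2 - v * h3
  · linear_combination (-x) * h1 - v * h2 + u * h3
  · linear_combination (-v) * h1 + x * h2 - y * h3
  · linear_combination u * h1 + y * h2 + x * h3

theorem W_mu_parametrization (φ : Matrix (Fin 2) (Fin 3) ℂ)
    (hne : φ ≠ 0) (hW : inW φ) (hmu : mu φ = 0) :
    (∃ a b c d l : ℝ, (a, b, c, d) ≠ (0, 0, 0, 0) ∧ φ = Psi a b c d l) ∨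
    (∃ a b c d : ℝ, (a, b, c, d) ≠ (0, 0, 0, 0) ∧ φ = M2 a b c d) := by
  obtain ⟨x1, y1, h00⟩ : ∃ x y : ℝ, φ 0 0 = ⟨x, y⟩ := ⟨_, _, rfl⟩
  obtain ⟨x2, y2, h01⟩ : ∃ x y : ℝ, φ 0 1 = ⟨x, y⟩ := ⟨_, _, rfl⟩
  obtain ⟨x3, y3, h02⟩ : ∃ x y : ℝ, φ 0 2 = ⟨x, y⟩ := ⟨_, _, rfl⟩
  obtain ⟨u1, v1, h10⟩ : ∃ x y : ℝ, φ 1 0 = ⟨x, y⟩ := ⟨_, _, rfl⟩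
  obtain ⟨u2, v2, h11⟩ : ∃ x y : ℝ, φ 1 1 = ⟨x, y⟩ := ⟨_, _, rfl⟩
  obtain ⟨u3, v3, h12⟩ : ∃ x y : ℝ, φ 1 2 = ⟨x, y⟩ := ⟨_, _, rfl⟩
  have hφ : φ = !![⟨x1, y1⟩, ⟨x2, y2⟩, ⟨x3, y3⟩; ⟨u1, v1⟩, ⟨u2, v2⟩, ⟨u3, v3⟩] := by
    ext i j
    fin_cases i <;> fin_cases j <;> simp [h00, h01, h02, h10, h11, h12]
  have hWa := hW 1 0 0 0
  have hWb := hW 0 1 0 0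
  have hWc := hW 0 0 1 0
  have hWd := hW 0 0 0 1
  simp [ip, iota, Matrix.trace, Matrix.mul_apply, Fin.sum_univ_succ, h00, h01, h02, h10, h11, h12]
    at hWa hWb hWc hWd
  have hm00 := congrFun (congrFun hmu 0) 0
  have hm01 := congrFun (congrFun hmu 0) 1
  simp [mu, Matrix.trace, Matrix.mul_apply, Fin.sum_univ_succ, h00, h01, h02, h10, h11, h12,
    Complex.ext_iff] at hm00 hm01
  obtain ⟨hm00, -⟩ := hm00
  obtain ⟨hm01, hm01'⟩ := hm01
  obtain rfl : y1 = -u2 - v3 := by linarith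
  obtain rfl : x1 = u3 - v2 := by linarith
  obtain rfl : v1 = x2 + y3 := by linarith
  obtain rfl : u1 = y2 - x3 := by linarith
  by_cases hp : x2 ^ 2 + y2 ^ 2 + u2 ^ 2 + v2 ^ 2 = 0
  · right
    obtain rfl : x2 = 0 := by nlinarith [sq_nonneg x2, sq_nonneg y2, sq_nonneg u2, sq_nonneg v2]
    obtain rfl : y2 = 0 := by nlinarith [sq_nonneg y2, sq_nonneg u2, sq_nonneg v2]
    obtain rfl : u2 = 0 := by nlinarith [sq_nonneg u2, sq_nonneg v2]
    obtain rfl : v2 = 0 := by nlinarith [sq_nonneg v2]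
    have hφ' : φ = M2 (-v3) (-u3) y3 x3 := by
      rw [hφ]
      ext i j
      fin_cases i <;> fin_cases j <;> simp [M2, Complex.ext_iff]
    refine ⟨-v3, -u3, y3, x3, fun h => hne ?_, hφ'⟩
    simp only [Prod.mk.injEq] at h
    obtain ⟨ha, hb, hc, hd⟩ := h
    rw [hφ', ha, hb, hc, hd]
    ext i j
    fin_cases i <;> fin_cases j <;> simp [M2, Complex.ext_iff]
  · left
    obtain ⟨t, rfl, rfl, rfl, rfl⟩ := exists_real_smul_of_im_conj_mul_eq_zero hp
      (x' := x3) (y' := y3) (u' := u3) (v' := v3)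
      (by linarith) (by linarith) (by linarith)
    refine ⟨-u2, v2, x2, -y2, -t, fun h => hp ?_, ?_⟩
    · simp only [Prod.mk.injEq, neg_eq_zero] at h
      obtain ⟨rfl, rfl, rfl, rfl⟩ := h
      ring
    · rw [hφ]
      ext i j
      fin_cases i <;> fin_cases j <;> simp [Psi, Complex.ext_iff] <;> ring_nf
end
end

section
/- Let (a,b,c,d) ∈ ℝ⁴ with (a,b,c,d) ≠ (0,0,0,0), let λ ∈ ℝ, and set w = Ψ(a,b,c,d,λ). For real α, β, γ, δ and s = ι(α,β,γ,δ), the equation w·s* + s·w* = (1/2)·tr(w·s* + s·w*)·1₂ holds if and only if there exists t ∈ ℝ such that (α,β,γ,δ) = t·(−b+λa, a+λb, −d+λc, c+λd). (This identifies the fiber of the normal line bundle N over W^μ.) -/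
open Matrix

noncomputable section

/-- For nonzero `(p, q, r, s)`, the three other vectors of the quaternionic orthogonal frame it
generates have the real line through `(p, q, r, s)` as common orthogonal complement. -/
theorem orthogonal_quaternion_frame_iff {p q r s : ℝ} (hN : p ^ 2 + q ^ 2 + r ^ 2 + s ^ 2 ≠ 0)
    (α β γ δ : ℝ) :
    (q * α - p * β - s * γ + r * δ = 0 ∧ s * α - r * β + q * γ - p * δ = 0 ∧
      r * α + s * β - p * γ - q * δ = 0) ↔
      ∃ t : ℝ, (α, β, γ, δ) = (t * p, t * q, t * r, t * s) := by
  constructor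
  · rintro ⟨h₁, h₂, h₃⟩
    refine ⟨(p * α + q * β + r * γ + s * δ) / (p ^ 2 + q ^ 2 + r ^ 2 + s ^ 2), ?_⟩
    simp only [Prod.mk.injEq, div_mul_eq_mul_div, eq_div_iff hN]
    refine ⟨?_, ?_, ?_, ?_⟩
    · linear_combination q * h₁ + s * h₂ + r * h₃
    · linear_combination -p * h₁ - r * h₂ + s * h₃
    · linear_combination -s * h₁ + q * h₂ - p * h₃
    · linear_combination r * h₁ - p * h₂ - q * h₃
  · rintro ⟨t, ht⟩
    simp only [Prod.mk.injEq] at ht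
    obtain ⟨rfl, rfl, rfl, rfl⟩ := ht
    refine ⟨?_, ?_, ?_⟩ <;> ring

/-- A 2×2 matrix equals half its trace times the identity iff it is scalar. -/
theorem eq_half_trace_smul_one_iff (A : Matrix (Fin 2) (Fin 2) ℂ) :
    A = ((1 / 2 : ℂ) * Matrix.trace A) • (1 : Matrix (Fin 2) (Fin 2) ℂ) ↔
      A 0 0 = A 1 1 ∧ A 0 1 = 0 ∧ A 1 0 = 0 := by
  rw [← Matrix.ext_iff]
  simp only [Fin.forall_fin_two, Matrix.trace_fin_two, Matrix.smul_apply, Matrix.one_apply_eq,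
    Matrix.one_apply_ne zero_ne_one, Matrix.one_apply_ne one_ne_zero, smul_eq_mul, mul_one,
    mul_zero]
  constructor
  · rintro ⟨⟨h₀, h₁⟩, h₂, -⟩
    exact ⟨by linear_combination 2 * h₀, h₁, h₂⟩
  · rintro ⟨h₀, h₁, h₂⟩
    exact ⟨⟨by linear_combination h₀ / 2, h₁⟩, h₂, by linear_combination -h₀ / 2⟩

theorem normal_line_bundle_fiber (a b c d l : ℝ)
    (h : (a, b, c, d) ≠ (0, 0, 0, 0)) (α β γ δ : ℝ) :
    Psi a b c d l * (iota α β γ δ)ᴴ + iota α β γ δ * (Psi a b c d l)ᴴ =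
      ((1 / 2 : ℂ) * Matrix.trace (Psi a b c d l * (iota α β γ δ)ᴴ +
        iota α β γ δ * (Psi a b c d l)ᴴ)) • (1 : Matrix (Fin 2) (Fin 2) ℂ) ↔
      ∃ t : ℝ, (α, β, γ, δ) =
        (t * (-b + l * a), t * (a + l * b), t * (-d + l * c), t * (c + l * d)) := by
  have hN : (-b + l * a) ^ 2 + (a + l * b) ^ 2 + (-d + l * c) ^ 2 + (c + l * d) ^ 2 ≠ 0 := by
    intro h0
    have hsum : a ^ 2 + b ^ 2 + c ^ 2 + d ^ 2 = 0 := by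
      refine (mul_eq_zero.mp ?_).resolve_left (by positivity : (1 + l ^ 2) ≠ 0)
      linear_combination h0
    refine h ?_
    simp only [Prod.mk.injEq]
    refine ⟨?_, ?_, ?_, ?_⟩ <;> nlinarith [sq_nonneg a, sq_nonneg b, sq_nonneg c, sq_nonneg d]
  rw [eq_half_trace_smul_one_iff, ← orthogonal_quaternion_frame_iff hN]
  simp only [Psi, iota, Matrix.add_apply, Matrix.mul_apply, Matrix.conjTranspose_apply,
    Fin.sum_univ_three, Complex.ext_iff]
  simp
  constructor
  · rintro ⟨⟨h₁, -⟩, ⟨h₂, h₃⟩, -⟩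
    refine ⟨?_, ?_, ?_⟩
    · linear_combination h₁ / 4
    · linear_combination h₂ / 2
    · linear_combination h₃ / 2
  · rintro ⟨h₁, h₂, h₃⟩
    refine ⟨⟨?_, ?_⟩, ⟨?_, ?_⟩, ?_, ?_⟩
    · linear_combination 4 * h₁
    · ring
    · linear_combination 2 * h₂
    · linear_combination 2 * h₃
    · linear_combination 2 * h₂
    · linear_combination -2 * h₃
end
end

section
/- For all real numbers a, b, c, d, λ, the matrix n(a,b,c,d,λ) := ι(−b+λa, a+λb, −d+λc, c+λd) is orthogonal to the Killing vector matrix K(a,b,c,d,λ) with respect to the real inner product: ⟨n(a,b,c,d,λ), K(a,b,c,d,λ)⟩ = 0. -/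
open Matrix

noncomputable section

/-- The Killing vector matrix K(a,b,c,d,λ). -/
def Kv (a b c d l : ℝ) : Matrix (Fin 2) (Fin 3) ℂ :=
  !![⟨-b * l - a, -b + a * l⟩, ⟨-d, -c⟩, ⟨l * d, l * c⟩;
     ⟨-(l * d) - c, -d + l * c⟩, ⟨b, a⟩, ⟨-(l * b), -(l * a)⟩]

theorem normal_orthogonal_to_killing (a b c d l : ℝ) :
    ip (iota (-b + l * a) (a + l * b) (-d + l * c) (c + l * d)) (Kv a b c d l) = 0 := by
  simp only [ip, Matrix.trace, Matrix.diag_apply, Matrix.mul_apply, Matrix.conjTranspose_apply,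
    Fin.sum_univ_two, Fin.sum_univ_three]
  simp [iota, Kv]
  ring
end
end

section
/- For all real numbers a, b, c, d, λ with (a,b,c,d) ≠ (0,0,0,0), the four matrices nI(a,b,c,d,λ), nJ(a,b,c,d,λ), nK(a,b,c,d,λ), and ∂̃λ(a,b,c,d,λ) are linearly independent over ℝ (so they span a 4-dimensional real subspace of the space of 2×3 complex matrices). -/
open Matrix

noncomputable section

/-- nI(a,b,c,d,λ). -/
def nI (a b c d l : ℝ) : Matrix (Fin 2) (Fin 3) ℂ :=
  !![⟨b - l * a, a + l * b⟩, ⟨-c - l * d, d - l * c⟩, ⟨-d + l * c, c + l * d⟩;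
     ⟨d - l * c, -c - l * d⟩, ⟨a + l * b, -b + l * a⟩, ⟨b - l * a, a + l * b⟩]

/-- nJ(a,b,c,d,λ). -/
def nJ (a b c d l : ℝ) : Matrix (Fin 2) (Fin 3) ℂ :=
  !![⟨c + l * d, -d + l * c⟩, ⟨b - l * a, a + l * b⟩, ⟨-a - l * b, -b + l * a⟩;
     ⟨-a - l * b, b - l * a⟩, ⟨d - l * c, c + l * d⟩, ⟨-c - l * d, -d + l * c⟩]

/-- nK(a,b,c,d,λ). -/
def nK (a b c d l : ℝ) : Matrix (Fin 2) (Fin 3) ℂ :=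
  !![⟨d - l * c, c + l * d⟩, ⟨a + l * b, b - l * a⟩, ⟨b - l * a, a + l * b⟩;
     ⟨-b - l * a, -a - l * b⟩, ⟨c + l * d, d - l * c⟩, ⟨d - l * c, -c - l * d⟩]

/-- The modified vector field ∂̃λ(a,b,c,d,λ). -/
def dtl (a b c d l : ℝ) : Matrix (Fin 2) (Fin 3) ℂ :=
  !![⟨a + l * b, b - l * a⟩, ⟨-(l * c), l * d⟩, ⟨-c, d⟩;
     ⟨c + l * d, d - l * c⟩, ⟨l * a, -(l * b)⟩, ⟨a, -b⟩]

lemma eq_zero_of_add_mul_eq_zero {a b l : ℝ} (hA : a + l * b = 0) (hB : b - l * a = 0) :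
    a = 0 ∧ b = 0 := by
  have hl : 1 + l ^ 2 ≠ 0 := by positivity
  refine ⟨mul_left_cancel₀ hl ?_, mul_left_cancel₀ hl ?_⟩
  · linear_combination hA - l * hB
  · linear_combination hB + l * hA

/-- A real linear relation with nonzero coefficient on `dtl` is possible only for `a = b = c = d = 0`.
The hypotheses are ten of the twelve real coordinates of the relation. -/
lemma eq_zero_of_dtl_coeff_ne_zero {a b c d l x y z w : ℝ} (hw : w ≠ 0)
    (h₁ : x * (b - l * a) + y * (c + l * d) + z * (d - l * c) + w * (a + l * b) = 0)
    (h₃ : x * (-c - l * d) + y * (b - l * a) + z * (a + l * b) + -(w * (l * c)) = 0)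
    (h₄ : x * (d - l * c) + y * (a + l * b) + z * (b - l * a) + w * (l * d) = 0)
    (h₅ : x * (-d + l * c) + y * (-a - l * b) + z * (b - l * a) + -(w * c) = 0)
    (h₆ : x * (c + l * d) + y * (-b + l * a) + z * (a + l * b) + w * d = 0)
    (h₈ : x * (-c - l * d) + y * (b - l * a) + z * (-a - l * b) + w * (d - l * c) = 0)
    (h₉ : x * (a + l * b) + y * (d - l * c) + z * (c + l * d) + w * (l * a) = 0)
    (h₁₀ : x * (-b + l * a) + y * (c + l * d) + z * (d - l * c) + -(w * (l * b)) = 0)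
    (h₁₁ : x * (b - l * a) + y * (-c - l * d) + z * (d - l * c) + w * a = 0)
    (h₁₂ : x * (a + l * b) + y * (-d + l * c) + z * (-c - l * d) + -(w * b) = 0) :
    a = 0 ∧ b = 0 ∧ c = 0 ∧ d = 0 := by
  have hlc : l * c = 2 * d := mul_left_cancel₀ hw (by linear_combination -h₆ - h₈)
  have hzA : 2 * z * (a + l * b) = w * d := by
    linear_combination h₃ + h₆ + w * hlc
  have hzd : w * (a - l * b) = 2 * z * d := by
    linear_combination h₁₀ + h₁₁ + 2 * z * hlc
  have hxA : 2 * x * (a + l * b) = w * (b - l * a) := by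
    linear_combination h₉ + h₁₂
  have hxB : 2 * x * (b - l * a) + w * (a + l * b) + w * (l * b) = 0 := by
    linear_combination h₁ - h₁₀
  have hzB : 2 * z * (b - l * a) = w * (c - l * d) := by
    linear_combination h₄ + h₅
  have hlb : w ^ 2 * (l * b) = -(w ^ 2 + 4 * x ^ 2) * (a + l * b) := by
    linear_combination w * hxB + 2 * x * hxA
  have hA : a + l * b = 0 := by
    by_contra hA
    have hz : z ≠ 0 := by
      rintro rfl
      have : (3 * w ^ 2 + 8 * x ^ 2) * (a + l * b) = 0 := by
        linear_combination w * hzd + 2 * hlb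
      exact hA ((mul_eq_zero.mp this).resolve_left (by positivity))
    have hB : (a + l * b) * (2 - l ^ 2) = l * (b - l * a) :=
      mul_left_cancel₀ (mul_ne_zero two_ne_zero hz)
        (by linear_combination (2 - l ^ 2) * hzA - l * hzB - w * hlc)
    have : (3 * w ^ 2 + 4 * x ^ 2 + l ^ 2 * (w ^ 2 + 4 * x ^ 2)) * (a + l * b) = 0 := by
      linear_combination w ^ 2 * hB + (1 + l ^ 2) * hlb
    exact hA ((mul_eq_zero.mp this).resolve_left (by positivity))
  have hd : d = 0 := by
    have : w * d = 0 := by rw [← hzA, hA, mul_zero]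
    exact (mul_eq_zero.mp this).resolve_left hw
  have hB : b - l * a = 0 := by
    have : w * (b - l * a) = 0 := by rw [← hxA, hA, mul_zero]
    exact (mul_eq_zero.mp this).resolve_left hw
  have hc : c = 0 := by
    have : w * c = 0 := by linear_combination -hzB + w * l * hd + 2 * z * hB
    exact (mul_eq_zero.mp this).resolve_left hw
  obtain ⟨ha, hb⟩ := eq_zero_of_add_mul_eq_zero hA hB
  exact ⟨ha, hb, hc, hd⟩

/-- A scalar annihilating the four coordinates `a + l * b`, `b - l * a`, `c + l * d`, `d - l * c`
of a nonzero vector vanishes. -/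
lemma scalar_eq_zero {a b c d l t : ℝ} (h : ¬(a = 0 ∧ b = 0 ∧ c = 0 ∧ d = 0))
    (hA : t * (a + l * b) = 0) (hB : t * (b - l * a) = 0)
    (hC : t * (c + l * d) = 0) (hE : t * (d - l * c) = 0) : t = 0 := by
  by_contra ht
  obtain ⟨ha, hb⟩ := eq_zero_of_add_mul_eq_zero ((mul_eq_zero.mp hA).resolve_left ht)
    ((mul_eq_zero.mp hB).resolve_left ht)
  obtain ⟨hc, hd⟩ := eq_zero_of_add_mul_eq_zero ((mul_eq_zero.mp hC).resolve_left ht)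
    ((mul_eq_zero.mp hE).resolve_left ht)
  exact h ⟨ha, hb, hc, hd⟩

theorem nIJK_dtl_linearly_independent (a b c d l : ℝ)
    (h : (a, b, c, d) ≠ (0, 0, 0, 0)) :
    LinearIndependent ℝ ![nI a b c d l, nJ a b c d l, nK a b c d l, dtl a b c d l] := by
  have hne : ¬(a = 0 ∧ b = 0 ∧ c = 0 ∧ d = 0) := by
    rintro ⟨rfl, rfl, rfl, rfl⟩
    exact h rfl
  rw [Fintype.linearIndependent_iff]
  intro g hg
  generalize hx : g 0 = x
  generalize hy : g 1 = y
  generalize hz : g 2 = z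
  generalize hw : g 3 = w
  simp only [Fin.sum_univ_four, hx, hy, hz, hw] at hg
  have entry (i : Fin 2) (j : Fin 3) := congrFun (congrFun hg i) j
  have e₀₀ := entry 0 0
  have e₀₁ := entry 0 1
  have e₀₂ := entry 0 2
  have e₁₀ := entry 1 0
  have e₁₁ := entry 1 1
  have e₁₂ := entry 1 2
  simp [nI, nJ, nK, dtl, Complex.ext_iff, -neg_sub, -neg_add_rev] at e₀₀ e₀₁ e₀₂ e₁₀ e₁₁ e₁₂
  obtain ⟨h₁, h₂⟩ := e₀₀
  obtain ⟨h₃, h₄⟩ := e₀₁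
  obtain ⟨h₅, h₆⟩ := e₀₂
  obtain ⟨h₇, h₈⟩ := e₁₀
  obtain ⟨h₉, h₁₀⟩ := e₁₁
  obtain ⟨h₁₁, h₁₂⟩ := e₁₂
  have hw0 : w = 0 := by
    by_contra hw0
    exact hne (eq_zero_of_dtl_coeff_ne_zero hw0 h₁ h₃ h₄ h₅ h₆ h₈ h₉ h₁₀ h₁₁ h₁₂)
  rw [hw0] at h₁ h₂ h₃ h₄ h₅ h₆ h₇ h₈ h₉ h₁₀ h₁₁ h₁₂
  have hxA : x * (a + l * b) = 0 := by linear_combination (h₉ + h₁₂) / 2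
  have hxB : x * (b - l * a) = 0 := by linear_combination (h₁ - h₁₀) / 2
  have hz0 : z = 0 := scalar_eq_zero (l := l) hne
    (by linear_combination (h₃ + h₆) / 2) (by linear_combination (h₄ + h₅) / 2)
    (by linear_combination (h₂ + h₉) / 2 - hxA) (by linear_combination (h₁₀ + h₁₁) / 2)
  rw [hz0] at h₁ h₃ h₄ h₇ h₉
  have hxE : x * (d - l * c) = 0 := by linear_combination (h₄ + h₇) / 2
  have hyA : y * (a + l * b) = 0 := by linear_combination (h₄ - h₇) / 2
  have hyC : y * (c + l * d) = 0 := by linear_combination h₁ - hxB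
  have hyE : y * (d - l * c) = 0 := by linear_combination h₉ - hxA
  have hxC : x * (c + l * d) = 0 := by
    have : x * (x * (c + l * d)) = 0 := by linear_combination y * hxB - x * h₃
    rcases mul_eq_zero.mp this with h0 | h0
    · rw [h0, zero_mul]
    · exact h0
  have hyB : y * (b - l * a) = 0 := by linear_combination h₃ + hxC
  have hx0 : x = 0 := scalar_eq_zero (l := l) hne hxA hxB hxC hxE
  have hy0 : y = 0 := scalar_eq_zero (l := l) hne hyA hyB hyC hyE
  intro i
  fin_cases i
  · exact hx.trans hx0
  · exact hy.trans hy0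
  · exact hz.trans hz0
  · exact hw.trans hw0
end
end

section
/- Let S(a,b,c,d,λ) be the real 4×4 matrix with rows (−2(λ²+1)b, 2(λ²+1)a, −2(λ²+1)d, 2(λ²+1)c), (2(2λ²+1)c−2λd, −2(2λ²+1)d−2λc, −2(2λ²+1)a+2λb, 2(2λ²+1)b+2λa), (−2(λ²+2)d+2λc, −2(λ²+2)c−2λd, 2(λ²+2)b−2λa, 2(λ²+2)a+2λb), and (a, b, c, d). Then for all real λ and all (a,b,c,d) ≠ (0,0,0,0), the determinant of S(a,b,c,d,λ) is strictly positive; in particular S(a,b,c,d,λ) is invertible. (This is the key computation showing the symbol of the linearized 3/2-Fueter operator is injective.) -/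
open Matrix

noncomputable section

/-- The real 4×4 symbol matrix S(a,b,c,d,λ). -/
def Smat (a b c d l : ℝ) : Matrix (Fin 4) (Fin 4) ℝ :=
  !![-2 * (l ^ 2 + 1) * b, 2 * (l ^ 2 + 1) * a, -2 * (l ^ 2 + 1) * d, 2 * (l ^ 2 + 1) * c;
     2 * (2 * l ^ 2 + 1) * c - 2 * l * d, -2 * (2 * l ^ 2 + 1) * d - 2 * l * c,
       -2 * (2 * l ^ 2 + 1) * a + 2 * l * b, 2 * (2 * l ^ 2 + 1) * b + 2 * l * a;
     -2 * (l ^ 2 + 2) * d + 2 * l * c, -2 * (l ^ 2 + 2) * c - 2 * l * d,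
       2 * (l ^ 2 + 2) * b - 2 * l * a, 2 * (l ^ 2 + 2) * a + 2 * l * b;
     a, b, c, d]

theorem det_Smat (a b c d l : ℝ) :
    (Smat a b c d l).det = 16 * (l ^ 2 + 1) ^ 3 * (a ^ 2 + b ^ 2 + c ^ 2 + d ^ 2) ^ 2 := by
  simp [Smat, det_succ_row_zero, Fin.sum_univ_succ, Fin.succAbove]
  ring

theorem symbol_matrix_det_pos (a b c d l : ℝ)
    (h : (a, b, c, d) ≠ (0, 0, 0, 0)) :
    0 < (Smat a b c d l).det ∧ IsUnit (Smat a b c d l) := by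
  have hpos : 0 < (Smat a b c d l).det := by
    have hsum : 0 < a ^ 2 + b ^ 2 + c ^ 2 + d ^ 2 := by
      refine lt_of_le_of_ne (by positivity) fun h0 => h ?_
      have ha : a = 0 := by nlinarith [sq_nonneg a, sq_nonneg b, sq_nonneg c, sq_nonneg d]
      have hb : b = 0 := by nlinarith [sq_nonneg a, sq_nonneg b, sq_nonneg c, sq_nonneg d]
      have hc : c = 0 := by nlinarith [sq_nonneg a, sq_nonneg b, sq_nonneg c, sq_nonneg d]
      have hd : d = 0 := by nlinarith [sq_nonneg a, sq_nonneg b, sq_nonneg c, sq_nonneg d]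
      rw [ha, hb, hc, hd]
    rw [det_Smat]
    positivity
  exact ⟨hpos, (isUnit_iff_isUnit_det _).2 hpos.ne'.isUnit⟩
end
end
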